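/- Let G be a 3-connected planar graph with vertex colors such that one vertex a is colored with a distinct color, and let k ≥ 2 be the size of the smallest color class other than the class containing a. Then the number of color-preserving automorphisms of G is at most 4k. -/

import Mathlib

open SimpleGraph

variable {V : Type*}

/-- `{a,b}` is a separating pair: removing both `a` and `b` disconnects the graph. -/
def SepPair (G : SimpleGraph V) (a b : V) : Prop :=
  a ≠ b ∧ ¬ (G.induce {v : V | v ≠ a ∧ v ≠ b}).Connected

/-- Two walks from `a` to `b` are internally vertex-disjoint. -/
def InternallyDisjoint (G : SimpleGraph V) {a b : V} (p q : G.Walk a b) : Prop :=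
  ∀ v : V, v ∈ p.support → v ∈ q.support → v = a ∨ v = b

/-- The pair `(a,b)` is 3-connected: there are at least three pairwise internally
vertex-disjoint paths between `a` and `b`. -/
def ThreeConnPair (G : SimpleGraph V) (a b : V) : Prop :=
  ∃ p q r : G.Path a b, InternallyDisjoint G p.1 q.1 ∧ InternallyDisjoint G p.1 r.1 ∧
    InternallyDisjoint G q.1 r.1

/-- `G` is biconnected: connected, at least 3 vertices, no articulation point. -/
def Biconnected (G : SimpleGraph V) : Prop :=
  G.Connected ∧ 3 ≤ Nat.card V ∧ ∀ v : V, (G.induce {u : V | u ≠ v}).Connected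

/-- `G` is 3-connected: at least 4 vertices and removing any at most 2 vertices
leaves it connected. -/
def ThreeConnectedGraph (G : SimpleGraph V) : Prop :=
  4 ≤ Nat.card V ∧ ∀ s : Set V, s.ncard ≤ 2 → (G.induce sᶜ).Connected

/-- Reversal of darts, as a permutation. -/
def dartRev (G : SimpleGraph V) : Equiv.Perm G.Dart :=
  ⟨SimpleGraph.Dart.symm, SimpleGraph.Dart.symm,
    fun d => SimpleGraph.Dart.symm_symm d, fun d => SimpleGraph.Dart.symm_symm d⟩

/-- A rotation scheme: a permutation of the darts fixing the tail of each dart and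
acting as a single rotation on the darts out of each vertex. -/
def RotationScheme (G : SimpleGraph V) (σ : Equiv.Perm G.Dart) : Prop :=
  (∀ d : G.Dart, (σ d).toProd.1 = d.toProd.1) ∧
    ∀ d e : G.Dart, d.toProd.1 = e.toProd.1 → ∃ n : ℕ, (σ ^ n) d = e

/-- The face-tracing permutation of a rotation scheme. -/
def facePerm (G : SimpleGraph V) (σ : Equiv.Perm G.Dart) : Equiv.Perm G.Dart :=
  (dartRev G).trans σ

/-- The faces of the combinatorial embedding, as a setoid on darts. -/
def faceSetoid (G : SimpleGraph V) (σ : Equiv.Perm G.Dart) : Setoid G.Dart :=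
  ⟨(facePerm G σ).SameCycle,
    ⟨fun x => Equiv.Perm.SameCycle.refl _ x, Equiv.Perm.SameCycle.symm,
      Equiv.Perm.SameCycle.trans⟩⟩

/-- The number of faces of the embedding given by the rotation scheme `σ`. -/
noncomputable def faceCount (G : SimpleGraph V) (σ : Equiv.Perm G.Dart) : ℕ :=
  Nat.card (Quotient (faceSetoid G σ))

/-- `σ` is a planar embedding of `G`: a rotation scheme satisfying Euler's formula. -/
def IsPlanarEmbedding (G : SimpleGraph V) (σ : Equiv.Perm G.Dart) : Prop :=
  RotationScheme G σ ∧
    (Nat.card V : ℤ) - (Nat.card G.edgeSet : ℤ) + (faceCount G σ : ℤ) = 2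

/-- `G` is planar: it admits a planar (combinatorial) embedding. -/
def HasPlanarEmbedding (G : SimpleGraph V) : Prop :=
  ∃ σ : Equiv.Perm G.Dart, IsPlanarEmbedding G σ

/-- A face of the embedding: an orbit of the face-tracing permutation. -/
def IsFace (G : SimpleGraph V) (σ : Equiv.Perm G.Dart) (f : Set G.Dart) : Prop :=
  ∃ d : G.Dart, f = {e : G.Dart | (facePerm G σ).SameCycle d e}

/-- Vertex `v` lies on the boundary of the face `f`. -/
def OnFace {G : SimpleGraph V} (f : Set G.Dart) (v : V) : Prop :=
  ∃ d ∈ f, d.toProd.1 = v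


section Aux

open Classical

/-- Darts are connected under rotation and reversal, away from a vertex set `C`. -/
def OffConn (G : SimpleGraph V) (C : Set V) : Prop :=
  ∀ P : V → Prop, (∀ u w, u ∉ C → w ∉ C → G.Adj u w → (P u ↔ P w)) →
    ∀ u w, u ∉ C → w ∉ C → (P u ↔ P w)

theorem offConn_of_connected (G : SimpleGraph V) (C : Set V)
    (h : (G.induce Cᶜ).Connected) : OffConn G C := by
  intro P hP u w hu hw
  obtain ⟨p⟩ := h.preconnected ⟨u, hu⟩ ⟨w, hw⟩
  have key : ∀ (x y : (Cᶜ : Set V)), (G.induce Cᶜ).Walk x y → (P x ↔ P y) := by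
    intro x y p
    induction p with
    | nil => rfl
    | @cons x' y' _ hadj _ ih => exact (hP x'.1 y'.1 x'.2 y'.2 hadj).trans ih
  exact key _ _ p

theorem rot_pow_fst {G : SimpleGraph V} {σ : Equiv.Perm G.Dart} (hR : RotationScheme G σ)
    (n : ℕ) (d : G.Dart) : ((σ ^ n) d).fst = d.fst := by
  induction n with
  | zero => rfl
  | succ n ih => rw [pow_succ', Equiv.Perm.mul_apply]; exact (hR.1 _).trans ih

theorem rot_symm_fst {G : SimpleGraph V} {σ : Equiv.Perm G.Dart} (hR : RotationScheme G σ)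
    (d : G.Dart) : (σ.symm d).fst = d.fst := by
  have := hR.1 (σ.symm d)
  rw [Equiv.apply_symm_apply] at this
  exact this.symm

theorem const_at_vertex {G : SimpleGraph V} {σ : Equiv.Perm G.Dart} (hR : RotationScheme G σ)
    {β : Type*} (h : G.Dart → β) (v : V) (hh : ∀ d : G.Dart, d.fst = v → h (σ d) = h d)
    (d e : G.Dart) (hd : d.fst = v) (he : e.fst = v) : h d = h e := by
  obtain ⟨n, rfl⟩ := hR.2 d e (hd.trans he.symm)
  clear he
  induction n with
  | zero => rfl
  | succ n ih =>
    rw [pow_succ', Equiv.Perm.mul_apply, hh _ ((rot_pow_fst hR n d).trans hd)]; exact ih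

theorem offConn_darts {G : SimpleGraph V} {σ : Equiv.Perm G.Dart} (hR : RotationScheme G σ)
    {C : Set V} (hC : OffConn G C) {β : Type*} (h : G.Dart → β)
    (hs : ∀ d : G.Dart, d.fst ∉ C → h d.symm = h d)
    (hσ : ∀ d : G.Dart, d.fst ∉ C → h (σ d) = h d)
    (d e : G.Dart) (hd : d.fst ∉ C) (he : e.fst ∉ C) : h d = h e := by
  have key : ∀ u w, u ∉ C → w ∉ C → G.Adj u w →
      (∀ e : G.Dart, e.fst = u → h e = h d) → (∀ e : G.Dart, e.fst = w → h e = h d) := by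
    intro u w hu hw huw hP e he
    have h1 := hP ⟨(u, w), huw⟩ rfl
    have h2 := hs ⟨(u, w), huw⟩ hu
    rw [← h1, ← h2]
    exact const_at_vertex hR h w (fun d hd => hσ d (by rw [hd]; exact hw)) _ _ he rfl
  have := hC (fun u => ∀ e : G.Dart, e.fst = u → h e = h d)
    (fun u w hu hw huw => ⟨key u w hu hw huw, key w u hw hu huw.symm⟩) d.fst e.fst hd he
  refine (this.1 ?_ e rfl).symm
  intro e he
  exact const_at_vertex hR h d.fst (fun d' hd' => hσ d' (by rw [hd']; exact hd)) _ _ he rfl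

theorem conn_darts {G : SimpleGraph V} {σ : Equiv.Perm G.Dart} (hR : RotationScheme G σ)
    (hC : OffConn G ∅) {β : Type*} (h : G.Dart → β)
    (hs : ∀ d : G.Dart, h d.symm = h d)
    (hσ : ∀ d : G.Dart, h (σ d) = h d) (d e : G.Dart) : h d = h e :=
  offConn_darts hR hC h (fun d _ => hs d) (fun d _ => hσ d) d e (by simp) (by simp)

/-- The Jordan property: every conservative flow is a boundary of a face potential. -/
def Jordan [Fintype V] (G : SimpleGraph V) (σ : Equiv.Perm G.Dart) : Prop :=
  ∀ z : G.Dart → ℚ, (∀ d, z d.symm = - z d) →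
    (∀ v, ∑ d : G.Dart with d.fst = v, z d = 0) →
    ∃ x : G.Dart → ℚ, (∀ d, x (σ d) = x d.symm) ∧ ∀ d, x d - x d.symm = z d

theorem sum_symm [Fintype V] (G : SimpleGraph V) (f : G.Dart → ℚ) :
    ∑ d, f (SimpleGraph.Dart.symm d) = ∑ d, f d :=
  Equiv.sum_comp (dartRev G) f

theorem orth [Fintype V] {G : SimpleGraph V} {σ : Equiv.Perm G.Dart} (hR : RotationScheme G σ)
    (w : V → ℚ) (x : G.Dart → ℚ) (hx : ∀ d, x (σ d) = x d.symm) :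
    ∑ d : G.Dart, (w d.fst - w d.snd) * (x d - x d.symm) = 0 := by
  have h1 : ∑ d : G.Dart, w d.snd * (x d - x d.symm)
      = ∑ d : G.Dart, w d.fst * (x d.symm - x d) := by
    rw [← sum_symm]
    exact Finset.sum_congr rfl fun d _ => by simp
  have h2 : ∑ d : G.Dart, w d.fst * x d.symm = ∑ d : G.Dart, w d.fst * x d := by
    rw [← Equiv.sum_comp σ (fun d : G.Dart => w d.fst * x d)]
    exact Finset.sum_congr rfl fun d _ => by
      have : (σ d).fst = d.fst := hR.1 d
      rw [this, hx]
  simp only [sub_mul, Finset.sum_sub_distrib, h1]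
  simp only [mul_sub, Finset.sum_sub_distrib, h2]
  ring

theorem jordan_of_planar [Fintype V] {G : SimpleGraph V} {σ : Equiv.Perm G.Dart}
    (hp : IsPlanarEmbedding G σ) (hC : OffConn G ∅) (d0 : G.Dart) : Jordan G σ := by
  obtain ⟨hR, hE⟩ := hp
  intro z hz hdiv
  let F := Quotient (faceSetoid G σ)
  let mk : G.Dart → F := fun d => Quotient.mk (faceSetoid G σ) d
  have hmk : ∀ d, mk (σ d) = mk d.symm := by
    intro d
    refine Quotient.sound (s := faceSetoid G σ) ?_
    change (facePerm G σ).SameCycle (σ d) d.symm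
    have : σ d = facePerm G σ d.symm := by simp [facePerm, dartRev]
    rw [this]
    exact (Equiv.Perm.sameCycle_apply_left).2 (Equiv.Perm.SameCycle.refl _ _)
  have hed : ∀ e : G.edgeSet, ∃ d : G.Dart, d.edge = e.1 := by
    rintro ⟨e, he⟩
    induction e with
    | _ u v => exact ⟨⟨(u, v), he⟩, rfl⟩
  choose ed hed using hed
  have hanti : ∀ y : G.Dart → ℚ, (∀ d, y d.symm = - y d) → (∀ e, y (ed e) = 0) → ∀ d, y d = 0 := by
    intro y hy h0 d
    have h1 := hed ⟨d.edge, d.edge_mem⟩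
    rcases SimpleGraph.dart_edge_eq_iff _ _ |>.1 h1 with h | h
    · rw [← h]; exact h0 _
    · have := h0 ⟨d.edge, d.edge_mem⟩
      rw [h, hy] at this
      linarith
  let T : ((V → ℚ) × (F → ℚ)) →ₗ[ℚ] (G.edgeSet → ℚ) × ℚ × ℚ :=
    { toFun := fun p => (fun e => (p.1 (ed e).fst - p.1 (ed e).snd)
          + (p.2 (mk (ed e)) - p.2 (mk (ed e).symm)), p.1 d0.fst, p.2 (mk d0))
      map_add' := by
        intro p q
        refine Prod.ext ?_ (Prod.ext ?_ ?_)
        · funext e; simp; ring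
        · simp
        · simp
      map_smul' := by
        intro c p
        refine Prod.ext ?_ (Prod.ext ?_ ?_)
        · funext e; simp; ring
        · simp
        · simp }
  have hfin : Module.finrank ℚ ((V → ℚ) × (F → ℚ)) =
      Module.finrank ℚ ((G.edgeSet → ℚ) × ℚ × ℚ) := by
    simp only [Module.finrank_prod, Module.finrank_fintype_fun_eq_card, Module.finrank_self]
    have h1 : faceCount G σ = Fintype.card F := Nat.card_eq_fintype_card
    rw [h1, Nat.card_eq_fintype_card, Nat.card_eq_fintype_card] at hE
    omega
  have hfull : ∀ (w : V → ℚ) (x : F → ℚ) (z : G.Dart → ℚ), (∀ d, z d.symm = - z d) →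
      (∀ e, (w (ed e).fst - w (ed e).snd) + (x (mk (ed e)) - x (mk (ed e).symm)) = z (ed e)) →
      ∀ d, (w d.fst - w d.snd) + (x (mk d) - x (mk d.symm)) = z d := by
    intro w x z hz h d
    have := hanti (fun d => (w d.fst - w d.snd) + (x (mk d) - x (mk d.symm)) - z d)
      (fun d => by simp [hz]; ring) (fun e => by simp [h e]) d
    linarith
  have hsplit : ∀ (w : V → ℚ) (x : F → ℚ) (z : G.Dart → ℚ),
      (∀ v, ∑ d : G.Dart with d.fst = v, z d = 0) → (∀ d, z d.symm = - z d) →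
      (∀ d, (w d.fst - w d.snd) + (x (mk d) - x (mk d.symm)) = z d) →
      ∀ d : G.Dart, w d.fst - w d.snd = 0 := by
    intro w x z hdiv hz h
    have ho := orth hR w (fun d => x (mk d)) (fun d => by simp [hmk])
    have hzw : ∑ d : G.Dart, w d.fst * z d = 0 := by
      rw [← Finset.sum_fiberwise (s := Finset.univ) (g := fun d : G.Dart => d.fst)]
      refine Finset.sum_eq_zero fun v _ => ?_
      rw [Finset.sum_congr rfl (g := fun d => w v * z d)
        (fun d hd => by rw [(Finset.mem_filter.1 hd).2]), ← Finset.mul_sum, hdiv, mul_zero]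
    have hzw2 : ∑ d : G.Dart, w d.snd * z d = 0 := by
      rw [← sum_symm]
      simp [hz, hzw]
    have hsq : ∑ d : G.Dart, (w d.fst - w d.snd) * (w d.fst - w d.snd) = 0 := by
      have : ∑ d : G.Dart, (w d.fst - w d.snd) * (w d.fst - w d.snd)
        = ∑ d : G.Dart, (w d.fst * z d - w d.snd * z d
          - (w d.fst - w d.snd) * (x (mk d) - x (mk d.symm))) := by
        refine Finset.sum_congr rfl fun d _ => ?_
        rw [← h d]; ring
      rw [this]
      simp only [Finset.sum_sub_distrib] at ho ⊢
      rw [hzw, hzw2, ho]; simp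
    intro d
    have := (Finset.sum_eq_zero_iff_of_nonneg (fun d _ => mul_self_nonneg _)).1 hsq d
      (Finset.mem_univ d)
    exact mul_self_eq_zero.1 this
  have hinj : Function.Injective T := by
    rw [← LinearMap.ker_eq_bot, LinearMap.ker_eq_bot']
    rintro ⟨w, x⟩ h
    have h1 : ∀ e, (w (ed e).fst - w (ed e).snd) + (x (mk (ed e)) - x (mk (ed e).symm)) = 0 :=
      fun e => congrFun (congrArg Prod.fst h) e
    have h2 : w d0.fst = 0 := congrArg (fun p => p.2.1) h
    have h3 : x (mk d0) = 0 := congrArg (fun p => p.2.2) h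
    have h4 := hfull w x (fun _ => 0) (by simp) h1
    have h5 := hsplit w x (fun _ => 0) (by simp) (by simp) h4
    have hw : w = 0 := by
      funext v
      have := hC (fun v => w v = 0) (fun u v _ _ huv => by
        have := h5 ⟨(u, v), huv⟩
        simp only at this
        constructor <;> intro h <;> linarith) d0.fst v (by simp) (by simp)
      exact this.1 h2
    have hx : x = 0 := by
      funext f
      induction f using Quotient.inductionOn with
      | _ d =>
        have hs : ∀ d : G.Dart, x (mk d.symm) = x (mk d) := by
          intro d
          have a1 := h4 d
          have a2 := h5 d
          linarith
        have := conn_darts hR hC (fun d => x (mk d)) hs (fun d => by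
          simp only [hmk]; exact hs d) d d0
        exact this.trans h3
    rw [hw, hx]; rfl
  have hsurj := (LinearMap.injective_iff_surjective_of_finrank_eq_finrank hfin).1 hinj
  obtain ⟨⟨w, x⟩, hwx⟩ := hsurj (fun e => z (ed e), 0, 0)
  have h1 : ∀ e, (w (ed e).fst - w (ed e).snd) + (x (mk (ed e)) - x (mk (ed e).symm)) = z (ed e) :=
    fun e => congrFun (congrArg Prod.fst hwx) e
  have h4 := hfull w x z hz h1
  have h5 := hsplit w x z hdiv hz h4
  refine ⟨fun d => x (mk d), fun d => by simp [hmk], fun d => ?_⟩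
  have a1 := h4 d
  have a2 := h5 d
  simp only
  linarith

end Aux

section AuxB

open Classical

theorem ncard_pair_le_two (u v : V) : ({u, v} : Set V).ncard ≤ 2 := by
  have := Set.ncard_insert_le u ({v} : Set V)
  rw [Set.ncard_singleton] at this
  exact this

theorem jordan_corner [Fintype V] {G : SimpleGraph V} {σ : Equiv.Perm G.Dart}
    (hR : RotationScheme G σ) (hJ : Jordan G σ) (N κ : G.Dart → ℚ)
    (hN : ∀ d, N d.symm - N (σ d) = κ (σ d))
    (hκ : ∀ v, ∑ d : G.Dart with d.fst = v, κ d = 0) :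
    ∃ y : G.Dart → ℚ, (∀ d, y d.symm = y d) ∧ ∀ d, y (σ d) = y d + κ (σ d) := by
  have hre : ∀ (f : G.Dart → ℚ) (v : V), ∑ d : G.Dart with d.fst = v, f (σ d)
      = ∑ d : G.Dart with d.fst = v, f d := by
    intro f v
    refine Finset.sum_equiv σ (fun d => ?_) (fun d _ => rfl)
    simp only [Finset.mem_filter, Finset.mem_univ, true_and]
    have : (σ d).fst = d.fst := hR.1 d
    rw [this]
  obtain ⟨x, hx, hxz⟩ := hJ (fun d => N d - N d.symm) (fun d => by simp) (fun v => by
    have h1 := hre κ v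
    have h2 := hre N v
    rw [hκ] at h1
    rw [Finset.sum_sub_distrib, ← h2, ← Finset.sum_sub_distrib]
    rw [← neg_eq_zero, ← Finset.sum_neg_distrib, ← h1]
    exact Finset.sum_congr rfl fun d _ => by rw [← hN]; ring)
  refine ⟨fun d => x d - N d, fun d => ?_, fun d => ?_⟩
  · have := hxz d
    simp only at this ⊢
    linarith
  · have h1 := hxz d
    have h2 := hx d
    have h3 := hN d
    simp only at h1 h2 h3 ⊢
    linarith

theorem face_succ {G : SimpleGraph V} {σ : Equiv.Perm G.Dart} (d : G.Dart) :
    facePerm G σ d = σ d.symm := rfl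

theorem face_symm {G : SimpleGraph V} {σ : Equiv.Perm G.Dart} (d : G.Dart) :
    facePerm G σ d.symm = σ d := by rw [face_succ, SimpleGraph.Dart.symm_symm]

theorem face_fst {G : SimpleGraph V} {σ : Equiv.Perm G.Dart} (hR : RotationScheme G σ)
    (d : G.Dart) : (facePerm G σ d).fst = d.snd := hR.1 d.symm

theorem sc_symm {G : SimpleGraph V} {σ : Equiv.Perm G.Dart} {e d : G.Dart} :
    (facePerm G σ).SameCycle e (σ d) ↔ (facePerm G σ).SameCycle e d.symm := by
  rw [← face_symm, Equiv.Perm.sameCycle_apply_right]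

theorem faceSegment [Fintype V] {G : SimpleGraph V} {σ : Equiv.Perm G.Dart} (e1 e2 : G.Dart)
    (h : (facePerm G σ).SameCycle e1 e2) :
    ∃ N : G.Dart → ℚ, ∀ d, N d.symm - N (σ d)
      = (if σ d = e2 then 1 else 0) - (if σ d = e1 then 1 else 0) := by
  obtain ⟨n, -, rfl⟩ := h.exists_pow_eq'
  refine ⟨fun d => ∑ i ∈ Finset.range n, if ((facePerm G σ) ^ i) e1 = d then 1 else 0, ?_⟩
  intro d
  simp only
  have h1 : ∀ i, (((facePerm G σ) ^ i) e1 = d.symm) ↔ (((facePerm G σ) ^ (i + 1)) e1 = σ d) := by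
    intro i
    rw [pow_succ', Equiv.Perm.mul_apply, ← face_symm (σ := σ) d, EmbeddingLike.apply_eq_iff_eq]
  simp only [h1]
  rw [← Finset.sum_sub_distrib,
    Finset.sum_range_sub (fun i => if ((facePerm G σ) ^ i) e1 = σ d then (1 : ℚ) else 0)]
  simp [eq_comm]

theorem sum_ind [Fintype V] {G : SimpleGraph V} (e : G.Dart) (v : V) :
    ∑ d : G.Dart with d.fst = v, (if d = e then (1 : ℚ) else 0) = if e.fst = v then 1 else 0 := by
  rw [Finset.sum_ite_eq']
  simp

theorem face_simple [Fintype V] {G : SimpleGraph V} {σ : Equiv.Perm G.Dart}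
    (hR : RotationScheme G σ) (hJ : Jordan G σ) (h1 : ∀ v, OffConn G {v}) (e1 e2 : G.Dart)
    (h : (facePerm G σ).SameCycle e1 e2) (hf : e1.fst = e2.fst) : e1 = e2 := by
  by_contra hne
  obtain ⟨N, hN⟩ := faceSegment e1 e2 h
  obtain ⟨y, hy, hyσ⟩ := jordan_corner hR hJ N
    (fun d => (if d = e2 then 1 else 0) - (if d = e1 then 1 else 0)) hN (fun v => by
      rw [Finset.sum_sub_distrib, sum_ind, sum_ind, hf]; simp)
  have hoff := offConn_darts hR (h1 e1.fst) y (fun d _ => hy d) (fun d hd => by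
    have hd' : (σ d).fst = d.fst := hR.1 d
    have a1 : σ d ≠ e1 := fun h => hd (by rw [← hd', h]; simp)
    have a2 : σ d ≠ e2 := fun h => hd (by rw [← hd', h, hf]; simp)
    rw [hyσ]; simp [a1, a2])
  have hall : ∀ d e : G.Dart, d.fst = e1.fst → e.fst = e1.fst → y d = y e := by
    intro d e hd he
    rw [← hy d, ← hy e]
    refine hoff _ _ ?_ ?_
    · simp only [Set.mem_singleton_iff]; rw [← hd]; exact d.adj.ne'
    · simp only [Set.mem_singleton_iff]; rw [← he]; exact e.adj.ne'
  have := hyσ (σ.symm e1)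
  rw [Equiv.apply_symm_apply] at this
  simp [hne] at this
  have h2 := hall e1 (σ.symm e1) rfl (rot_symm_fst hR e1)
  linarith

theorem face_pair [Fintype V] {G : SimpleGraph V} {σ : Equiv.Perm G.Dart}
    (hR : RotationScheme G σ) (hJ : Jordan G σ) (h2 : ∀ u v, OffConn G {u, v})
    (e1 e2 f1 f2 : G.Dart)
    (he : (facePerm G σ).SameCycle e1 e2) (hf : (facePerm G σ).SameCycle f1 f2)
    (hef : ¬ (facePerm G σ).SameCycle e1 f1) (hu : f1.fst = e1.fst) (hv : f2.fst = e2.fst)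
    (huv : e1.fst ≠ e2.fst) :
    (e1.snd = e2.fst ∧ σ e1 = f1) ∨ (f1.snd = e2.fst ∧ σ f1 = e1) := by
  obtain ⟨N, hN⟩ := faceSegment e1 e2 he
  obtain ⟨M, hM⟩ := faceSegment f2 f1 hf.symm
  obtain ⟨y, hy, hyσ⟩ := jordan_corner hR hJ (fun d => N d + M d)
    (fun d => ((if d = e2 then 1 else 0) - (if d = e1 then 1 else 0))
      + ((if d = f1 then 1 else 0) - (if d = f2 then 1 else 0)))
    (fun d => by rw [← hN, ← hM]; ring) (fun v => by
      rw [Finset.sum_add_distrib, Finset.sum_sub_distrib, Finset.sum_sub_distrib,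
        sum_ind, sum_ind, sum_ind, sum_ind, hu, hv]; ring)
  have hoff := offConn_darts hR (h2 e1.fst e2.fst) y (fun d _ => hy d) (fun d hd => by
    have hd' : (σ d).fst = d.fst := hR.1 d
    have a1 : σ d ≠ e1 := fun h => hd (by rw [← hd', h]; simp)
    have a2 : σ d ≠ e2 := fun h => hd (by rw [← hd', h]; simp)
    have a3 : σ d ≠ f1 := fun h => hd (by rw [← hd', h, hu]; simp)
    have a4 : σ d ≠ f2 := fun h => hd (by rw [← hd', h, hv]; simp)
    rw [hyσ]; simp [a1, a2, a3, a4])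
  have hall : ∀ d e : G.Dart, d.fst = e1.fst → e.fst = e1.fst → d.snd ≠ e2.fst →
      e.snd ≠ e2.fst → y d = y e := by
    intro d e hd he hd2 he2
    rw [← hy d, ← hy e]
    refine hoff _ _ ?_ ?_
    · rintro (h | h)
      · rw [← hd] at h; exact d.adj.ne' h
      · exact hd2 h
    · rintro (h | h)
      · rw [← he] at h; exact e.adj.ne' h
      · exact he2 h
  have n1 : e1 ≠ e2 := fun h => huv (by rw [h])
  have n2 : e1 ≠ f1 := fun h => hef (by rw [h])
  have n3 : e1 ≠ f2 := fun h => huv (by rw [← hv, h])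
  have n4 : f1 ≠ e2 := fun h => huv (by rw [← hu, h])
  have n5 : f1 ≠ f2 := fun h => huv (by rw [← hu, ← hv, h])
  have s1 := hyσ (σ.symm e1)
  have s2 := hyσ (σ.symm f1)
  rw [Equiv.apply_symm_apply] at s1 s2
  simp [n1, n2, n3] at s1
  simp [n4, n2.symm, n5] at s2
  have uniq : ∀ d e : G.Dart, d.fst = e1.fst → e.fst = e1.fst → d.snd = e2.fst →
      e.snd = e2.fst → d = e := by
    intro d e a b c f
    refine SimpleGraph.Dart.ext _ _ (Prod.ext (a.trans b.symm) (c.trans f.symm))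
  have r1 : e1.snd = e2.fst ∨ (σ.symm e1).snd = e2.fst := by
    by_contra! hcon
    have := hall e1 (σ.symm e1) rfl (rot_symm_fst hR e1) hcon.1 hcon.2
    linarith
  have r2 : f1.snd = e2.fst ∨ (σ.symm f1).snd = e2.fst := by
    by_contra! hcon
    have := hall f1 (σ.symm f1) hu ((rot_symm_fst hR f1).trans hu) hcon.1 hcon.2
    linarith
  rcases r1 with r1 | r1 <;> rcases r2 with r2 | r2
  · exact absurd (uniq _ _ rfl hu r1 r2) n2
  · left
    refine ⟨r1, ?_⟩
    rw [uniq _ _ rfl ((rot_symm_fst hR f1).trans hu) r1 r2, Equiv.apply_symm_apply]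
  · right
    refine ⟨r2, ?_⟩
    rw [uniq _ _ hu (rot_symm_fst hR e1) r2 r1, Equiv.apply_symm_apply]
  · have := uniq _ _ (rot_symm_fst hR e1) ((rot_symm_fst hR f1).trans hu) r1 r2
    exact absurd (σ.symm.injective this) n2

/-- The standing facts about a planar embedding of a 3-connected graph. -/
structure Good [Fintype V] (G : SimpleGraph V) (σ : Equiv.Perm G.Dart) : Prop where
  rot : RotationScheme G σ
  jor : Jordan G σ
  off0 : OffConn G ∅
  off1 : ∀ v, OffConn G {v}
  off2 : ∀ u v, OffConn G {u, v}
  deg1 : ∀ d, σ d ≠ d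
  deg2 : ∀ d, σ (σ d) ≠ d
  ex : ∀ v, ∃ d : G.Dart, d.fst = v

theorem third_vertex [Fintype V] {G : SimpleGraph V} (h3 : ThreeConnectedGraph G)
    (v u w : V) : ∃ x, G.Adj v x ∧ x ≠ u ∧ x ≠ w := by
  by_contra! hcon
  obtain ⟨hc, h⟩ := h3
  set S : Set V := ({u, w} : Set V) \ {v} with hS
  have hS2 : S.ncard ≤ 2 := (Set.ncard_sdiff_singleton_le _ _).trans (ncard_pair_le_two u w)
  have hconn := offConn_of_connected G S (h S hS2)
  have hv : v ∉ S := by simp [hS]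
  have hx : ∃ x, x ∉ insert v S := by
    by_contra! hall
    have : (insert v S) = Set.univ := Set.eq_univ_of_forall hall
    have h4 := Set.ncard_insert_le v S
    rw [this, Set.ncard_univ] at h4
    omega
  obtain ⟨x, hx⟩ := hx
  have hx1 : x ≠ v := fun h => hx (by simp [h])
  have hx2 : x ∉ S := fun h => hx (by simp [h])
  have key : ∀ a, G.Adj v a → a ∈ S := by
    intro a ha
    refine ⟨?_, ha.ne'⟩
    by_cases hau : a = u
    · simp [hau]
    · simp [hcon a ha hau]
  have := hconn (fun a => a = v) (fun a b ha hb hab => by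
    constructor
    · rintro rfl; exact absurd (key b hab) hb
    · rintro rfl; exact absurd (key a hab.symm) ha) v x hv hx2
  exact hx1 (this.1 rfl)

theorem good_of_planar [Fintype V] {G : SimpleGraph V} {σ : Equiv.Perm G.Dart}
    (h3 : ThreeConnectedGraph G) (hp : IsPlanarEmbedding G σ) : Good G σ := by
  have hR := hp.1
  have off0 : OffConn G ∅ := offConn_of_connected G ∅ (h3.2 ∅ (by simp))
  have ex : ∀ v, ∃ d : G.Dart, d.fst = v := fun v => by
    obtain ⟨x, hx, -⟩ := third_vertex h3 v v v
    exact ⟨⟨(v, x), hx⟩, rfl⟩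
  have hne : Nonempty V := by
    by_contra hc
    rw [not_nonempty_iff] at hc
    have := h3.1
    simp at this
  have deg2 : ∀ d, σ (σ d) ≠ d := by
    intro d hd
    obtain ⟨x, hx, hx1, hx2⟩ := third_vertex h3 d.fst d.snd (σ d).snd
    obtain ⟨n, hn⟩ := hR.2 d ⟨(d.fst, x), hx⟩ rfl
    have : ∀ n : ℕ, (σ ^ n) d = d ∨ (σ ^ n) d = σ d := by
      intro n
      induction n with
      | zero => left; rfl
      | succ n ih =>
        rw [pow_succ', Equiv.Perm.mul_apply]
        rcases ih with ih | ih <;> simp [ih, hd]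
    rcases this n with h | h
    · apply hx1; rw [← h, hn]
    · apply hx2; rw [← h, hn]
  refine ⟨hR, ?_, off0, fun v => offConn_of_connected G _ (h3.2 _ (by simp)),
    fun u v => offConn_of_connected G _ (h3.2 _ (ncard_pair_le_two u v)), ?_, deg2, ex⟩
  · obtain ⟨v⟩ := hne
    obtain ⟨d, -⟩ := ex v
    exact jordan_of_planar hp off0 d
  · intro d hd
    exact deg2 d (by rw [hd, hd])

end AuxB

section AuxC

open Classical

/-- The vertices on the face through `f`. -/
def faceVerts (G : SimpleGraph V) (σ : Equiv.Perm G.Dart) (f : G.Dart) : Set V :=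
  {v | ∃ d, (facePerm G σ).SameCycle f d ∧ d.fst = v}

variable [Fintype V] {G : SimpleGraph V} {σ : Equiv.Perm G.Dart}

theorem Good.simple (hg : Good G σ) {e1 e2 : G.Dart}
    (h : (facePerm G σ).SameCycle e1 e2) (hf : e1.fst = e2.fst) : e1 = e2 :=
  face_simple hg.rot hg.jor hg.off1 e1 e2 h hf

theorem Good.not_both (hg : Good G σ) {f d : G.Dart}
    (h : (facePerm G σ).SameCycle f d) : ¬ (facePerm G σ).SameCycle f d.symm := by
  intro h2
  have h3 := sc_symm.2 h2
  exact hg.deg1 d (hg.simple (h3.symm.trans h) (hg.rot.1 d))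

theorem Good.off_head (hg : Good G σ) {f d p : G.Dart}
    (hd : (facePerm G σ).SameCycle f d) (hp : p.fst = d.fst) (h1 : p ≠ d) (h2 : σ p ≠ d) :
    p.snd ∉ faceVerts G σ f := by
  rintro ⟨e, he, hep⟩
  have hpf : ¬ (facePerm G σ).SameCycle d p := fun h => h1 (hg.simple h hp.symm).symm
  have := face_pair hg.rot hg.jor hg.off2 d e p (facePerm G σ p) (hd.symm.trans he)
    (Equiv.Perm.sameCycle_apply_right.2 (Equiv.Perm.SameCycle.refl _ _)) hpf hp
    (by rw [face_fst hg.rot, hep]) (by rw [hep, ← hp]; exact p.adj.ne)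
  rcases this with ⟨h, -⟩ | ⟨-, h⟩
  · exact h1 (SimpleGraph.Dart.ext _ _ (Prod.ext hp (by rw [← hep]; exact h.symm)))
  · exact h2 h

theorem Good.other_face (hg : Good G σ) {f : G.Dart} (P : V → Prop)
    (hP : ∀ u w, u ∉ faceVerts G σ f → w ∉ faceVerts G σ f → G.Adj u w → (P u ↔ P w))
    (e e' : G.Dart) (hee : (facePerm G σ).SameCycle e e')
    (hef : ¬ (facePerm G σ).SameCycle f e) (he : e.fst ∉ faceVerts G σ f)
    (he' : e'.fst ∉ faceVerts G σ f) : P e.fst ↔ P e'.fst := by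
  set φ := facePerm G σ with hφ
  set C := faceVerts G σ f with hC
  have hstep : ∀ x : G.Dart, x.fst ∉ C → (φ x).fst ∉ C → (P x.fst ↔ P (φ x).fst) := by
    intro x hx hx'
    refine hP _ _ hx hx' ?_
    rw [face_fst hg.rot]; exact x.adj
  by_cases hall : ∀ n : ℕ, ((φ ^ n) e).fst ∉ C
  · obtain ⟨n, -, rfl⟩ := hee.exists_pow_eq'
    clear he' hee
    induction n with
    | zero => rfl
    | succ n ih =>
      have h1 := hall (n + 1)
      rw [pow_succ', Equiv.Perm.mul_apply] at h1 ⊢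
      exact ih.trans (hstep _ (hall n) h1)
  push Not at hall
  obtain ⟨m, hm⟩ := hall
  -- find a start
  have hstart : ∃ p, φ.SameCycle e p ∧ p.fst ∈ C ∧ (φ p).fst ∉ C := by
    by_contra! hcon
    have hx : φ.SameCycle e ((φ ^ m) e) :=
      Equiv.Perm.sameCycle_pow_right.2 (Equiv.Perm.SameCycle.refl _ _)
    obtain ⟨n, -, hn⟩ := hx.symm.exists_pow_eq'
    have : ∀ n : ℕ, ((φ ^ n) ((φ ^ m) e)).fst ∈ C := by
      intro n
      induction n with
      | zero => exact hm
      | succ n ih =>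
        rw [pow_succ', Equiv.Perm.mul_apply]
        exact hcon _ (Equiv.Perm.sameCycle_pow_right.2 hx) ih
    exact he (by have := this n; rwa [hn] at this)
  obtain ⟨p, hep, hpC, hpoff⟩ := hstart
  have hret : ∃ k : ℕ, ((φ ^ (k + 1)) (φ p)).fst ∈ C := by
    refine ⟨orderOf φ - 1 + (orderOf φ - 1), ?_⟩
    have h0 : 0 < orderOf φ := orderOf_pos φ
    have : (φ ^ (orderOf φ - 1 + (orderOf φ - 1) + 1)) (φ p) = (φ ^ (orderOf φ + orderOf φ)) p := by
      rw [← Equiv.Perm.mul_apply, ← pow_succ]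
      congr 2; omega
    rw [this, pow_add, pow_orderOf_eq_one]
    exact hpC
  set k := Nat.find hret with hk
  have hkC : ((φ ^ (k + 1)) (φ p)).fst ∈ C := Nat.find_spec hret
  have hkoff : ∀ i ≤ k, ((φ ^ i) (φ p)).fst ∉ C := by
    intro i hi
    cases i with
    | zero => exact hpoff
    | succ i => exact Nat.find_min hret (by omega)
  have hkP : ∀ i ≤ k, (P (φ p).fst ↔ P ((φ ^ i) (φ p)).fst) := by
    intro i
    induction i with
    | zero => intro _; rfl
    | succ i ih =>
      intro hi
      have h1 := hkoff (i + 1) hi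
      rw [pow_succ', Equiv.Perm.mul_apply] at h1 ⊢
      exact (ih (by omega)).trans (hstep _ (hkoff i (by omega)) h1)
  set q := (φ ^ (k + 1)) (φ p) with hq
  have hpq : φ.SameCycle p q :=
    Equiv.Perm.sameCycle_pow_right.2 (Equiv.Perm.sameCycle_apply_right.2 (Equiv.Perm.SameCycle.refl _ _))
  have hqp : q = p ∨ φ q = p := by
    by_cases hf : q.fst = p.fst
    · left; exact hg.simple hpq.symm hf
    · right
      obtain ⟨p', hp', hpp⟩ := hpC
      obtain ⟨q', hq', hqq⟩ := hkC
      have hnot : ¬ φ.SameCycle p' p := fun h => hef ((hp'.trans h).trans hep.symm)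
      rcases face_pair hg.rot hg.jor hg.off2 p' q' p q (hp'.symm.trans hq') hpq hnot
        hpp.symm hqq.symm (by rw [hpp, hqq]; exact fun h => hf h.symm) with ⟨h1, h2⟩ | ⟨h1, h2⟩
      · -- this dart goes from u to v; its reverse lies on the other face
        have h3 : φ p'.symm = p := by rw [← h2]; exact face_symm p'
        have h4 : p'.symm = q := by
          refine hg.simple ?_ ?_
          · refine Equiv.Perm.SameCycle.trans ?_ hpq
            rw [← h3]
            exact Equiv.Perm.sameCycle_apply_right.2 (Equiv.Perm.SameCycle.refl _ _)
          · rw [← hqq, ← h1]; rfl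
        rw [← h4]; exact h3
      · exfalso
        apply hpoff
        rw [face_fst hg.rot, h1, hqq]
        exact ⟨q', hq', hqq⟩
  have hclosed : ∀ n : ℕ, (φ ^ n) p = p ∨ ∃ i ≤ k + 1, (φ ^ n) p = (φ ^ i) (φ p) := by
    intro n
    induction n with
    | zero => left; rfl
    | succ n ih =>
      rw [pow_succ', Equiv.Perm.mul_apply]
      rcases ih with ih | ⟨i, hi, ih⟩
      · right; exact ⟨0, by omega, by rw [ih]; rfl⟩
      · rw [ih]
        rcases Nat.lt_or_eq_of_le hi with hi | rfl
        · right; exact ⟨i + 1, by omega, by rw [pow_succ' _ i, Equiv.Perm.mul_apply]⟩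
        · rcases hqp with h | h
          · right; refine ⟨0, by omega, ?_⟩
            rw [← hq, h]; rfl
          · left; exact h
  have hfin : ∀ x, φ.SameCycle p x → x.fst ∉ C → (P (φ p).fst ↔ P x.fst) := by
    intro x hx hxC
    obtain ⟨n, -, rfl⟩ := hx.exists_pow_eq'
    rcases hclosed n with h | ⟨i, hi, h⟩
    · rw [h] at hxC; exact absurd hpC hxC
    · rw [h] at hxC ⊢
      rcases Nat.lt_or_eq_of_le hi with hi | rfl
      · exact hkP i (by omega)
      · exact absurd hkC hxC
  exact (hfin e hep.symm he).symm.trans (hfin e' (hep.symm.trans hee) he')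

theorem Good.peripheral (hg : Good G σ) (f : G.Dart) : OffConn G (faceVerts G σ f) := by
  intro P hP
  set φ := facePerm G σ with hφ
  set C := faceVerts G σ f with hC
  have hmem : ∀ d, φ.SameCycle f d → d.fst ∈ C := fun d hd => ⟨d, hd, rfl⟩
  have hmem2 : ∀ d, φ.SameCycle f d → d.snd ∈ C := fun d hd =>
    ⟨φ d, Equiv.Perm.sameCycle_apply_right.2 hd, face_fst hg.rot d⟩
  have hself : ∀ d, φ.SameCycle d (φ d) := fun d =>
    Equiv.Perm.sameCycle_apply_right.2 (Equiv.Perm.SameCycle.refl _ _)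
  -- labels at a vertex of the face
  have hlab : ∀ d, φ.SameCycle f d → ∀ p : G.Dart, p.fst = d.fst → p.snd ∉ C →
      (P p.snd ↔ P (σ d).snd) := by
    intro d hd p hp hpC
    obtain ⟨n, rfl⟩ := hg.rot.2 d p hp.symm
    have key : ∀ n : ℕ, (σ ^ n) d = d ∨ σ ((σ ^ n) d) = d ∨
        (P ((σ ^ n) d).snd ↔ P (σ d).snd) := by
      intro n
      induction n with
      | zero => left; rfl
      | succ n ih =>
        rw [pow_succ', Equiv.Perm.mul_apply]
        set r := (σ ^ n) d with hr
        have hrf : r.fst = d.fst := rot_pow_fst hg.rot n d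
        by_cases h1 : r = d
        · rw [h1]; right; right; rfl
        by_cases h2 : σ r = d
        · left; exact h2
        by_cases h3 : σ (σ r) = d
        · right; left; exact h3
        have ih' : P r.snd ↔ P (σ d).snd := by
          rcases ih with h | h | h
          · exact absurd h h1
          · exact absurd h h2
          · exact h
        right; right
        refine Iff.trans ?_ ih'
        have hsf : (σ r).fst = d.fst := (hg.rot.1 r).trans hrf
        have hr1 : r.snd ∉ C := hg.off_head hd hrf h1 h2
        have hr2 : (σ r).snd ∉ C := hg.off_head hd hsf h2 h3
        have hnf : ¬ φ.SameCycle f (σ r) := fun h =>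
          h2 (hg.simple (h.symm.trans hd) hsf)
        have hsc : φ.SameCycle r.symm (φ (σ r)) := by
          refine Equiv.Perm.sameCycle_apply_right.2 (sc_symm.2 (Equiv.Perm.SameCycle.refl _ _))
        have := hg.other_face P hP r.symm (φ (σ r)) hsc (fun h => hnf (sc_symm.2 h)) hr1
          (by rw [face_fst hg.rot]; exact hr2)
        rw [face_fst hg.rot] at this
        exact this.symm
    rcases key n with h | h | h
    · rw [h] at hpC; exact absurd (hmem2 d hd) hpC
    · exfalso
      apply hpC
      have : φ.SameCycle f (σ ((σ ^ n) d)) := by rw [h]; exact hd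
      exact hmem _ (sc_symm.1 this)
    · exact h
  -- labels along the face
  have hnext : ∀ d, φ.SameCycle f d → (P (σ d).snd ↔ P (σ (φ d)).snd) := by
    intro d hd
    have hd2 : φ.SameCycle f (φ d) := Equiv.Perm.sameCycle_apply_right.2 hd
    set r := σ.symm d.symm with hr
    have hσr : σ r = d.symm := by simp [hr]
    have hrf : r.fst = (φ d).fst := by
      rw [face_fst hg.rot, hr, rot_symm_fst hg.rot]; rfl
    have hφd : φ d = σ (σ r) := by rw [hσr]; rfl
    have hr1 : r.snd ∉ C := by
      refine hg.off_head hd2 hrf ?_ ?_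
      · rw [hφd]; exact (hg.deg2 r).symm
      · rw [hφd]; exact (hg.deg1 (σ r)).symm
    have hs1 : (σ d).snd ∉ C := hg.off_head hd (hg.rot.1 d) (hg.deg1 d) (hg.deg2 d)
    have hsc : φ.SameCycle r.symm (φ (σ d)) := by
      refine Equiv.Perm.sameCycle_apply_right.2 (sc_symm.2 ?_)
      rw [← hσr]
      exact sc_symm.2 (Equiv.Perm.SameCycle.refl _ _)
    have hnf : ¬ φ.SameCycle f r.symm := by
      intro h
      have := sc_symm.2 h
      rw [hσr] at this
      exact hg.not_both hd this
    have := hg.other_face P hP r.symm (φ (σ d)) hsc hnf hr1 (by rw [face_fst hg.rot]; exact hs1)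
    rw [face_fst hg.rot] at this
    exact this.symm.trans (hlab (φ d) hd2 r hrf hr1)
  have hconst : ∀ d, φ.SameCycle f d → (P (σ f).snd ↔ P (σ d).snd) := by
    intro d hd
    obtain ⟨n, -, rfl⟩ := hd.exists_pow_eq'
    clear hd
    induction n with
    | zero => rfl
    | succ n ih =>
      rw [pow_succ', Equiv.Perm.mul_apply]
      exact ih.trans (hnext _ (Equiv.Perm.sameCycle_pow_right.2 (Equiv.Perm.SameCycle.refl _ _)))
  have hcross : ∀ u w, u ∈ C → w ∉ C → G.Adj u w → (P (σ f).snd ↔ P w) := by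
    rintro u w ⟨d, hd, rfl⟩ hw huw
    exact (hconst d hd).trans (hlab d hd ⟨(d.fst, w), huw⟩ rfl hw).symm
  have hglob := hg.off0 (fun v => if v ∈ C then P (σ f).snd else P v) (fun u w _ _ huw => by
    by_cases hu : u ∈ C <;> by_cases hw : w ∈ C <;> simp only [hu, hw, if_true, if_false]
    · exact hcross u w hu hw huw
    · exact (hcross w u hw hu huw.symm).symm
    · exact hP u w hu hw huw)
  intro u w hu hw
  have := hglob u w (by simp) (by simp)
  simpa only [hu, hw, if_false] using this

end AuxC

section AuxD

open Classical

variable [Fintype V] {G : SimpleGraph V} {σ τ : Equiv.Perm G.Dart}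

/-- Whitney: local comparison of two embeddings. -/
theorem whitney_local (hg : Good G σ) (ht : Good G τ) (f : G.Dart) :
    ∃ (x : G.Dart → ℚ) (K : ℚ), x (facePerm G σ f) = x f ∧
      ∀ d, (facePerm G σ).SameCycle f d →
        ((τ d = σ.symm d ∧ x d = K) ∨ (τ (σ.symm d) = d ∧ x d = K + 1)) := by
  set φ := facePerm G σ with hφ
  set C := faceVerts G σ f with hC
  let N : G.Dart → ℚ := fun d => if φ.SameCycle f d then 1 else 0
  have hNσ : ∀ d, N (σ d) = N d.symm := by
    intro d
    simp only [N]
    exact if_congr sc_symm rfl rfl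
  obtain ⟨x, hx, hxz⟩ := ht.jor (fun d => N d - N d.symm) (fun d => by simp) (fun v => by
    rw [Finset.sum_sub_distrib, sub_eq_zero]
    symm
    refine Finset.sum_equiv σ (fun d => ?_) (fun d _ => (hNσ d).symm)
    simp only [Finset.mem_filter, Finset.mem_univ, true_and]
    have : (σ d).fst = d.fst := hg.rot.1 d
    rw [this])
  have hmem : ∀ d, φ.SameCycle f d → d.fst ∈ C := fun d hd => ⟨d, hd, rfl⟩
  have hmem2 : ∀ d, φ.SameCycle f d → d.snd ∈ C := fun d hd =>
    ⟨φ d, Equiv.Perm.sameCycle_apply_right.2 hd, face_fst hg.rot d⟩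
  have hsym : ∀ d : G.Dart, d.fst ∉ C → x d.symm = x d := by
    intro d hd
    have h1 : N d = 0 := if_neg fun h => hd (hmem d h)
    have h2 : N d.symm = 0 := if_neg fun h => hd (hmem2 _ h)
    have h3 := hxz d
    simp only [h1, h2] at h3
    linarith
  have hoff := offConn_darts ht.rot (hg.peripheral f) x hsym (fun d hd => by
    rw [hx]; exact hsym d hd)
  have hff : φ.SameCycle f f := Equiv.Perm.SameCycle.refl _ _
  have hother : ∀ d p, φ.SameCycle f d → p.fst = d.fst → p ≠ d → σ p ≠ d →
      x p = x (σ f).symm ∧ x (τ p) = x p := by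
    intro d p hd hp h1 h2
    have h3 : p.symm.fst ∉ C := hg.off_head hd hp h1 h2
    have h4 : (σ f).symm.fst ∉ C :=
      hg.off_head hff (hg.rot.1 f) (hg.deg1 f) (hg.deg2 f)
    have h5 := hsym _ h3
    rw [SimpleGraph.Dart.symm_symm] at h5
    refine ⟨h5.trans (hoff _ _ h3 h4), ?_⟩
    rw [hx]; exact h5.symm
  have hon : ∀ d, φ.SameCycle f d → x d.symm = x d - 1 := by
    intro d hd
    have h1 : N d = 1 := if_pos hd
    have h2 : N d.symm = 0 := if_neg (hg.not_both hd)
    have h3 := hxz d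
    simp only [h1, h2] at h3
    linarith
  have hres : ∀ d, φ.SameCycle f d →
      ((τ d = σ.symm d ∧ x d = x (σ f).symm) ∨
        (τ (σ.symm d) = d ∧ x d = x (σ f).symm + 1)) := by
    intro d hd
    have e1 : x (τ d) = x d - 1 := by rw [hx, hon d hd]
    by_cases c1 : τ d = σ.symm d
    · left
      refine ⟨c1, ?_⟩
      set r := τ.symm d with hr
      have hτr : τ r = d := by simp [hr]
      have hrf : r.fst = d.fst := rot_symm_fst ht.rot d
      have hrd : r ≠ d := fun h => ht.deg1 d (by rw [h] at hτr; exact hτr)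
      have hsr : σ r ≠ d := by
        intro h
        have : r = σ.symm d := by rw [← h]; simp
        rw [← c1] at this
        exact ht.deg2 d (by rw [← this, hτr])
      obtain ⟨a1, a2⟩ := hother d r hd hrf hrd hsr
      rw [hτr] at a2
      rw [a2, a1]
    · right
      have hsr : σ (τ d) ≠ d := by
        intro h
        exact c1 (by rw [Equiv.eq_symm_apply]; exact h)
      obtain ⟨a1, a2⟩ := hother d (τ d) hd (ht.rot.1 d) (ht.deg1 d) hsr
      have hv : x d = x (σ f).symm + 1 := by linarith
      refine ⟨?_, hv⟩
      by_contra c2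
      set r := τ.symm d with hr
      have hτr : τ r = d := by simp [hr]
      have hrf : r.fst = d.fst := rot_symm_fst ht.rot d
      have hrd : r ≠ d := fun h => ht.deg1 d (by rw [h] at hτr; exact hτr)
      have hsr : σ r ≠ d := by
        intro h
        have : r = σ.symm d := by rw [← h]; simp
        exact c2 (by rw [← this, hτr])
      obtain ⟨b1, b2⟩ := hother d r hd hrf hrd hsr
      rw [hτr] at b2
      linarith
  refine ⟨x, _, ?_, hres⟩
  have hd2 : φ.SameCycle f (φ f) := Equiv.Perm.sameCycle_apply_right.2 hff
  have hs : σ.symm (φ f) = f.symm := by rw [hφ, face_succ]; simp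
  have h1 := hon f hff
  rcases hres _ hd2 with ⟨a, -⟩ | ⟨a, -⟩
  · rw [hs] at a
    have h2 : x (τ (φ f)) = x (φ f) - 1 := by rw [hx, hon _ hd2]
    rw [a] at h2
    linarith
  · rw [hs] at a
    have h2 := hx f.symm
    rw [a, SimpleGraph.Dart.symm_symm] at h2
    exact h2

theorem whitney (hg : Good G σ) (ht : Good G τ) :
    (∀ d, τ d = σ d) ∨ (∀ d, τ d = σ.symm d) := by
  have hloc : ∀ d, τ d = σ.symm d ∨ τ (σ.symm d) = d := by
    intro d
    obtain ⟨x, K, -, h⟩ := whitney_local hg ht d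
    rcases h d (Equiv.Perm.SameCycle.refl _ _) with h | h
    · exact Or.inl h.1
    · exact Or.inr h.1
  have hnot : ∀ d, ¬ (τ d = σ.symm d ∧ τ (σ.symm d) = d) := by
    rintro d ⟨h1, h2⟩
    exact ht.deg2 d (by rw [h1, h2])
  have hφ : ∀ d, τ (σ.symm (facePerm G σ d)) = facePerm G σ d ↔ τ (σ.symm d) = d := by
    intro d
    obtain ⟨x, K, hx, h⟩ := whitney_local hg ht d
    have r1 := h d (Equiv.Perm.SameCycle.refl _ _)
    have r2 := h _ (Equiv.Perm.sameCycle_apply_right.2 (Equiv.Perm.SameCycle.refl _ d))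
    rw [hx] at r2
    rcases r1 with ⟨a, b⟩ | ⟨a, b⟩ <;> rcases r2 with ⟨c, e⟩ | ⟨c, e⟩
    · exact ⟨fun h => absurd ⟨c, h⟩ (hnot _), fun h => absurd ⟨a, h⟩ (hnot _)⟩
    · exfalso; linarith
    · exfalso; linarith
    · exact ⟨fun _ => a, fun _ => c⟩
  have hσ : ∀ d, τ (σ.symm (σ d)) = σ d ↔ τ (σ.symm d) = d := by
    intro d
    rw [Equiv.symm_apply_apply]
    have hne : σ d ≠ σ.symm d := fun h => hg.deg2 d (by rw [h]; simp)
    constructor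
    · intro h
      rcases hloc d with h' | h'
      · exact absurd (h.symm.trans h') hne
      · exact h'
    · intro h
      rcases hloc (σ d) with h' | h'
      · rw [Equiv.symm_apply_apply] at h'
        exact absurd (τ.injective (h'.trans h.symm)) hne
      · rw [Equiv.symm_apply_apply] at h'; exact h'
  have hα : ∀ d : G.Dart, τ (σ.symm d.symm) = d.symm ↔ τ (σ.symm d) = d := by
    intro d
    rw [← hφ d.symm, face_symm, hσ]
  have hc := conn_darts hg.rot hg.off0 (fun d => τ (σ.symm d) = d) (fun d => propext (hα d))
    (fun d => propext (hσ d))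
  by_cases hall : ∃ d, τ (σ.symm d) = d
  · left
    obtain ⟨d0, h0⟩ := hall
    intro d
    have := (hc d0 (σ d)).mp h0
    rwa [Equiv.symm_apply_apply] at this
  · right
    intro d
    rcases hloc d with h | h
    · exact h
    · exact absurd ⟨d, h⟩ hall

theorem sum_ind_int (e : G.Dart) (v : V) :
    ∑ d : G.Dart with d.fst = v, (if d = e then (1 : ℤ) else 0) = if e.fst = v then 1 else 0 := by
  rw [Finset.sum_ite_eq']
  simp

theorem exists_flow (a b c : V) (hac : a ≠ c) (hbc : b ≠ c) (ho : OffConn G {c}) :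
    ∃ γ : G.Dart → ℤ, (∀ d, γ d.symm = - γ d) ∧ (∀ d : G.Dart, d.fst = c → γ d = 0) ∧
      ∀ v, ∑ d : G.Dart with d.fst = v, γ d
        = (if a = v then 1 else 0) - (if b = v then 1 else 0) := by
  let P : V → Prop := fun w => ∃ γ : G.Dart → ℤ, (∀ d, γ d.symm = - γ d) ∧
      (∀ d : G.Dart, d.fst = c → γ d = 0) ∧
      ∀ v, ∑ d : G.Dart with d.fst = v, γ d
        = (if a = v then 1 else 0) - (if w = v then 1 else 0)
  have key : ∀ u w, u ∉ ({c} : Set V) → w ∉ ({c} : Set V) → G.Adj u w → P u → P w := by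
    rintro u w hu hw huw ⟨γ, h1, h2, h3⟩
    let p : G.Dart := ⟨(u, w), huw⟩
    refine ⟨fun d => γ d + ((if d = p then 1 else 0) - (if d = p.symm then 1 else 0)), ?_, ?_, ?_⟩
    · intro d
      have a1 : d.symm = p ↔ d = p.symm :=
        ⟨fun h => by rw [← h, SimpleGraph.Dart.symm_symm],
          fun h => by rw [h, SimpleGraph.Dart.symm_symm]⟩
      have a2 : d.symm = p.symm ↔ d = p := SimpleGraph.Dart.symm_involutive.injective.eq_iff
      simp only [a1, a2, h1]
      ring
    · intro d hd
      have a1 : d ≠ p := by rintro rfl; exact hu hd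
      have a2 : d ≠ p.symm := by rintro rfl; exact hw hd
      simp [a1, a2, h2 d hd]
    · intro v
      rw [Finset.sum_add_distrib, Finset.sum_sub_distrib, sum_ind_int, sum_ind_int, h3]
      change _ - (if u = v then (1 : ℤ) else 0) + ((if u = v then 1 else 0) - (if w = v then 1 else 0)) = _
      ring
  have := ho P (fun u w hu hw huw => ⟨key u w hu hw huw, key w u hw hu huw.symm⟩) a b
    (by simpa using hac) (by simpa using hbc)
  exact this.1 ⟨fun _ => 0, by simp, by simp, by simp⟩

theorem period_sum {V : Type*} {G : SimpleGraph V} {σ : Equiv.Perm G.Dart} (f : G.Dart → ℤ) (d : G.Dart) (N q : ℕ) (hN : (σ ^ N) d = d) :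
    ∑ l ∈ Finset.range (N * q), f ((σ ^ l) d) = q * ∑ l ∈ Finset.range N, f ((σ ^ l) d) := by
  induction q with
  | zero => simp
  | succ q ih =>
    have hq : ∀ q : ℕ, (σ ^ (N * q)) d = d := by
      intro q
      induction q with
      | zero => rfl
      | succ q ih => rw [Nat.mul_succ, pow_add, Equiv.Perm.mul_apply, hN, ih]
    have h2 : ∀ l, (σ ^ (N * q + l)) d = (σ ^ l) d := by
      intro l
      rw [add_comm, pow_add, Equiv.Perm.mul_apply, hq]
    rw [Nat.mul_succ, Finset.sum_range_add, ih]
    simp only [h2]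
    push_cast
    ring

/-- A rotation fixing three vertices is trivial. -/
theorem winding (hg : Good G σ) (ρ : Equiv.Perm G.Dart) (g : V → V) (hginj : Function.Injective g)
    (hρs : ∀ d, ρ d.symm = (ρ d).symm) (hρσ : ∀ d, ρ (σ d) = σ (ρ d))
    (hρf : ∀ d : G.Dart, (ρ d).fst = g d.fst) (a b c : V) (hab : a ≠ b) (hac : a ≠ c)
    (hbc : b ≠ c) (ga : g a = a) (gb : g b = b) (gc : g c = c) : ∀ d, ρ d = d := by
  obtain ⟨γ, h1, h2, h3⟩ := exists_flow a b c hac hbc (hg.off1 c)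
  obtain ⟨da, hda⟩ := hg.ex a
  obtain ⟨dc, hdc⟩ := hg.ex c
  obtain ⟨x, hx, hxz⟩ := hg.jor (fun d => ((γ d - γ (ρ d) : ℤ) : ℚ))
    (fun d => by simp only [hρs, h1]; push_cast; ring) (fun v => by
      rw [← Int.cast_sum, Finset.sum_sub_distrib]
      have : ∑ d : G.Dart with d.fst = v, γ (ρ d) = ∑ d : G.Dart with d.fst = g v, γ d := by
        refine Finset.sum_equiv ρ (fun d => ?_) (fun d _ => rfl)
        simp only [Finset.mem_filter, Finset.mem_univ, true_and, hρf]
        exact hginj.eq_iff.symm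
      rw [this, h3, h3]
      have e1 : a = g v ↔ a = v := ⟨fun h => hginj (ga.trans h), fun h => by rw [← h, ga]⟩
      have e2 : b = g v ↔ b = v := ⟨fun h => hginj (gb.trans h), fun h => by rw [← h, gb]⟩
      simp [e1, e2])
  have hint : ∀ d, ∃ n : ℤ, x d - x dc = n := by
    have hs : ∀ d : G.Dart, (∃ n : ℤ, x d.symm - x dc = n) ↔ ∃ n : ℤ, x d - x dc = n := by
      intro d
      have := hxz d
      constructor
      · rintro ⟨n, hn⟩
        exact ⟨n + (γ d - γ (ρ d)), by push_cast at this ⊢; linarith⟩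
      · rintro ⟨n, hn⟩
        exact ⟨n - (γ d - γ (ρ d)), by push_cast at this ⊢; linarith⟩
    intro d
    have := conn_darts hg.rot hg.off0 (fun d => ∃ n : ℤ, x d - x dc = n)
      (fun d => propext (hs d)) (fun d => by simp only [hx]; exact propext (hs d)) dc d
    exact this.mp ⟨0, by simp⟩
  choose X hX using hint
  have hXσ : ∀ d, X (σ d) = X d.symm := by
    intro d
    have e1 := hX (σ d)
    have e2 := hX d.symm
    rw [hx, e2] at e1
    exact_mod_cast e1.symm
  have hXs : ∀ d, X d.symm = X d - (γ d - γ (ρ d)) := by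
    intro d
    have e1 := hX d
    have e2 := hX d.symm
    have e3 := hxz d
    have : (X d.symm : ℚ) = ((X d - (γ d - γ (ρ d)) : ℤ) : ℚ) := by
      push_cast at e3 ⊢; linarith
    exact_mod_cast this
  have hXc0 : X dc = 0 := by
    have := hX dc
    rw [sub_self] at this
    exact_mod_cast this.symm
  have hXc : ∀ d : G.Dart, d.fst = c → X d = 0 := by
    intro d hd
    rw [← hXc0]
    refine const_at_vertex hg.rot X c (fun d hd => ?_) _ _ hd hdc
    rw [hXσ, hXs, h2 d hd, h2 (ρ d) (by rw [hρf, hd, gc])]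
    simp
  have hpowf : ∀ (v : V), g v = v → ∀ (i : ℕ) (d : G.Dart), d.fst = v → ((ρ ^ i) d).fst = v := by
    intro v hv i d hd
    induction i with
    | zero => exact hd
    | succ i ih => rw [pow_succ', Equiv.Perm.mul_apply, hρf, ih, hv]
  have hpows : ∀ (i : ℕ) (d : G.Dart), (ρ ^ i) d.symm = ((ρ ^ i) d).symm := by
    intro i d
    induction i with
    | zero => rfl
    | succ i ih => rw [pow_succ', Equiv.Perm.mul_apply, ih, hρs, Equiv.Perm.mul_apply]
  have hpowσ : ∀ (i : ℕ) (d : G.Dart), (ρ ^ i) (σ d) = σ ((ρ ^ i) d) := by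
    intro i d
    induction i with
    | zero => rfl
    | succ i ih => rw [pow_succ', Equiv.Perm.mul_apply, ih, hρσ, Equiv.Perm.mul_apply]
  set m := orderOf ρ with hm
  have hm0 : 0 < m := orderOf_pos ρ
  have hs : ∀ d, ∑ i ∈ Finset.range m, X ((ρ ^ i) d) = 0 := by
    have hsym : ∀ d : G.Dart, ∑ i ∈ Finset.range m, X ((ρ ^ i) d.symm)
        = ∑ i ∈ Finset.range m, X ((ρ ^ i) d) := by
      intro d
      have e : ∀ i, X ((ρ ^ i) d.symm) = X ((ρ ^ i) d) -
          (γ ((ρ ^ i) d) - γ ((ρ ^ (i + 1)) d)) := by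
        intro i
        rw [hpows, hXs, pow_succ', Equiv.Perm.mul_apply]
      simp only [e]
      rw [Finset.sum_sub_distrib, Finset.sum_range_sub' (fun i => γ ((ρ ^ i) d)), hm,
        pow_orderOf_eq_one]
      simp
    intro d
    have := conn_darts hg.rot hg.off0 (fun d => ∑ i ∈ Finset.range m, X ((ρ ^ i) d)) hsym
      (fun d => by
        rw [← hsym d]
        exact Finset.sum_congr rfl fun i _ => by rw [hpowσ, hXσ, hpows]) d dc
    rw [this]
    exact Finset.sum_eq_zero fun i _ => hXc _ (hpowf c gc i dc hdc)
  obtain ⟨n, hn⟩ := hg.rot.2 da (ρ da) (by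
    have := hρf da
    rw [hda, ga] at this
    rw [hda, this])
  have hρa : ∀ d : G.Dart, d.fst = a → ρ d = (σ ^ n) d := by
    have hcomm : ∀ d, (σ ^ n) (σ d) = σ ((σ ^ n) d) := by
      intro d
      rw [← Equiv.Perm.mul_apply, ← Equiv.Perm.mul_apply, ← pow_succ, ← pow_succ']
    intro d hd
    obtain ⟨j, rfl⟩ := hg.rot.2 da d (hda.trans hd.symm)
    clear hd
    induction j with
    | zero => exact hn.symm
    | succ j ih => rw [pow_succ', Equiv.Perm.mul_apply, hρσ, ih, hcomm]
  have hpowa : ∀ i : ℕ, (ρ ^ i) da = (σ ^ (n * i)) da := by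
    intro i
    induction i with
    | zero => rfl
    | succ i ih =>
      rw [pow_succ', Equiv.Perm.mul_apply, hρa _ (hpowf a ga i da hda), ih, Nat.mul_succ,
        add_comm, pow_add, Equiv.Perm.mul_apply]
  let Γ : G.Dart → ℤ := fun d => ∑ j ∈ Finset.range n, γ ((σ ^ j) d)
  have hΓ : ∀ d : G.Dart, d.fst = a → Γ (σ d) = Γ d - γ d + γ (ρ d) := by
    intro d hd
    have e1 := Finset.sum_range_succ (fun j => γ ((σ ^ j) d)) n
    have e2 := Finset.sum_range_succ' (fun j => γ ((σ ^ j) d)) n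
    have e3 : Γ (σ d) = ∑ j ∈ Finset.range n, γ ((σ ^ (j + 1)) d) :=
      Finset.sum_congr rfl fun j _ => by rw [pow_succ, Equiv.Perm.mul_apply]
    rw [hρa d hd, e3]
    change _ = (∑ j ∈ Finset.range n, γ ((σ ^ j) d)) - _ + _
    simp only [pow_zero, Equiv.Perm.one_apply] at e2
    linarith
  obtain ⟨c0, hc0⟩ : ∃ c0, ∀ d : G.Dart, d.fst = a → X d = c0 + Γ d := by
    refine ⟨X da - Γ da, fun d hd => ?_⟩
    have := const_at_vertex hg.rot (fun d => X d - Γ d) a (fun d hd => by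
      rw [hΓ d hd, hXσ, hXs]; ring) d da hd hda
    linarith
  have hB : ∀ i : ℕ, ∑ l ∈ Finset.range (n * i), γ ((σ ^ l) da)
      = ∑ k ∈ Finset.range i, Γ ((ρ ^ k) da) := by
    intro i
    induction i with
    | zero => simp
    | succ i ih =>
      rw [Nat.mul_succ, Finset.sum_range_add, ih, Finset.sum_range_succ, hpowa i]
      congr 1
      refine Finset.sum_congr rfl fun j _ => ?_
      rw [add_comm, pow_add, Equiv.Perm.mul_apply]
  have hsum := hs da
  rw [Finset.sum_congr rfl (fun i _ => hc0 _ (hpowf a ga i da hda)), Finset.sum_add_distrib,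
    ← hB m] at hsum
  simp only [Finset.sum_const, Finset.card_range, nsmul_eq_mul] at hsum
  set N := Function.minimalPeriod σ da with hN
  have hiter : ∀ l : ℕ, (σ ^ l) da = σ^[l] da := fun l => by rw [Equiv.Perm.iterate_eq_pow]
  have hNper : (σ ^ N) da = da := by
    rw [hiter]; exact Function.isPeriodicPt_minimalPeriod σ da
  have hnm : (σ ^ (n * m)) da = da := by
    rw [← hpowa, hm, pow_orderOf_eq_one]; rfl
  have hdvd : N ∣ n * m := by
    apply Function.IsPeriodicPt.minimalPeriod_dvd
    rw [hiter] at hnm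
    exact hnm
  obtain ⟨q, hq⟩ := hdvd
  have hN0 : 0 < N := by
    rw [hN]
    refine Function.minimalPeriod_pos_of_mem_periodicPts ?_
    refine ⟨orderOf σ, orderOf_pos σ, ?_⟩
    change σ^[orderOf σ] da = da
    rw [← hiter, pow_orderOf_eq_one]; rfl
  have hone : ∑ l ∈ Finset.range N, γ ((σ ^ l) da) = 1 := by
    have e := h3 a
    rw [if_pos rfl, if_neg hab.symm, sub_zero] at e
    rw [← e]
    refine Finset.sum_bij (fun l _ => (σ ^ l) da) ?_ ?_ ?_ ?_
    · intro l _
      simp [rot_pow_fst hg.rot, hda]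
    · intro l hl l' hl' h
      rw [hiter, hiter] at h
      exact Function.iterate_injOn_Iio_minimalPeriod (by simpa using hl) (by simpa using hl') h
    · intro d hd
      obtain ⟨j, rfl⟩ := hg.rot.2 da d (hda.trans (Finset.mem_filter.1 hd).2.symm)
      refine ⟨j % N, by simpa using Nat.mod_lt _ hN0, ?_⟩
      rw [hiter, hiter, hN, Function.iterate_mod_minimalPeriod_eq]
    · intro l _; rfl
  rw [hq, period_sum γ da N q hNper, hone] at hsum
  have hfix : ρ da = da := by
    rw [← hn]
    have hdn : (N : ℤ) ∣ n := by
      refine ⟨-c0, ?_⟩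
      have hm' : (m : ℤ) ≠ 0 := by exact_mod_cast hm0.ne'
      have hq' : (n : ℤ) * m = N * q := by exact_mod_cast hq
      apply mul_right_cancel₀ hm'
      rw [hq']
      have : (q : ℤ) = - (m * c0) := by linarith
      rw [this]; ring
    obtain ⟨t, ht⟩ := Int.natCast_dvd_natCast.1 hdn
    rw [ht, hiter]
    rw [hiter] at hNper
    exact (Function.IsPeriodicPt.mul_const (show Function.IsPeriodicPt σ N da from hNper) t)
  intro d
  have := conn_darts hg.rot hg.off0 (fun d => ρ d = d)
    (fun d => propext ⟨fun h => by
      rw [hρs] at h; exact SimpleGraph.Dart.symm_involutive.injective h,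
      fun h => by rw [hρs, h]⟩)
    (fun d => propext ⟨fun h => by rw [hρσ] at h; exact σ.injective h,
      fun h => by rw [hρσ, h]⟩) da d
  exact this.mp hfix

end AuxD

section AuxE

open Classical

/-- The action of a graph automorphism on darts. -/
def dartMap {G : SimpleGraph V} (g : G ≃g G) : Equiv.Perm G.Dart where
  toFun d := ⟨(g d.fst, g d.snd), g.map_rel_iff.2 d.adj⟩
  invFun d := ⟨(g.symm d.fst, g.symm d.snd), g.symm.map_rel_iff.2 d.adj⟩
  left_inv d := by
    refine SimpleGraph.Dart.ext _ _ (Prod.ext ?_ ?_) <;> simp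
  right_inv d := by
    refine SimpleGraph.Dart.ext _ _ (Prod.ext ?_ ?_) <;> simp

theorem dartMap_fst {G : SimpleGraph V} (g : G ≃g G) (d : G.Dart) :
    (dartMap g d).fst = g d.fst := rfl

theorem dartMap_symm {G : SimpleGraph V} (g : G ≃g G) (d : G.Dart) :
    dartMap g d.symm = (dartMap g d).symm := rfl

theorem dartMap_mul {G : SimpleGraph V} (g h : G ≃g G) :
    dartMap (g * h) = dartMap g * dartMap h := rfl

theorem dartMap_inv {G : SimpleGraph V} (g : G ≃g G) :
    dartMap g⁻¹ = (dartMap g)⁻¹ := rfl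

variable [Fintype V] {G : SimpleGraph V} {σ : Equiv.Perm G.Dart}

theorem planar_conj (hp : IsPlanarEmbedding G σ) (g : G ≃g G) :
    IsPlanarEmbedding G (dartMap g * σ * (dartMap g)⁻¹) := by
  obtain ⟨hR, hE⟩ := hp
  have hpow : ∀ n : ℕ, (dartMap g * σ * (dartMap g)⁻¹) ^ n
      = dartMap g * σ ^ n * (dartMap g)⁻¹ := fun n => conj_pow
  have hface : facePerm G (dartMap g * σ * (dartMap g)⁻¹)
      = dartMap g * facePerm G σ * (dartMap g)⁻¹ := by
    ext1 d
    rw [face_succ]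
    simp only [Equiv.Perm.mul_apply, face_succ]
    rw [← dartMap_inv, dartMap_symm]
  refine ⟨⟨fun d => ?_, fun d e hde => ?_⟩, ?_⟩
  · have h1 : (σ (dartMap g⁻¹ d)).fst = (dartMap g⁻¹ d).fst := hR.1 _
    change (dartMap g (σ (dartMap g⁻¹ d))).fst = d.fst
    rw [dartMap_fst, h1, dartMap_fst]
    exact g.apply_symm_apply _
  · obtain ⟨n, hn⟩ := hR.2 (dartMap g⁻¹ d) (dartMap g⁻¹ e) (by
      change g⁻¹ d.fst = g⁻¹ e.fst
      have : d.fst = e.fst := hde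
      rw [this])
    refine ⟨n, ?_⟩
    rw [hpow]
    simp only [Equiv.Perm.mul_apply]
    rw [← dartMap_inv, hn]
    exact (dartMap g).apply_symm_apply e
  · have : faceCount G (dartMap g * σ * (dartMap g)⁻¹) = faceCount G σ := by
      symm
      refine Nat.card_congr (Quotient.congr (dartMap g) ?_)
      intro d e
      change (facePerm G σ).SameCycle d e ↔
        (facePerm G (dartMap g * σ * (dartMap g)⁻¹)).SameCycle (dartMap g d) (dartMap g e)
      have hi : ∀ x, (dartMap g)⁻¹ (dartMap g x) = x := fun x => (dartMap g).symm_apply_apply x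
      rw [hface, Equiv.Perm.sameCycle_conj, hi, hi]
    rw [this]; exact hE

theorem auto_dichotomy (h3 : ThreeConnectedGraph G) (hp : IsPlanarEmbedding G σ) (g : G ≃g G) :
    dartMap g * σ * (dartMap g)⁻¹ = σ ∨ dartMap g * σ * (dartMap g)⁻¹ = σ⁻¹ := by
  rcases whitney (good_of_planar h3 hp) (good_of_planar h3 (planar_conj hp g)) with h | h
  · left; ext1 d; exact h d
  · right; ext1 d; exact h d

theorem conj_comm {g : G ≃g G} (h : dartMap g * σ * (dartMap g)⁻¹ = σ) (d : G.Dart) :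
    dartMap g (σ d) = σ (dartMap g d) := by
  have : dartMap g * σ = σ * dartMap g := by
    conv_rhs => rw [← h]
    simp
  exact congrArg (fun p : Equiv.Perm G.Dart => p d) this

theorem eq_one_of_dartMap (hg : Good G σ) {g : G ≃g G} (h : ∀ d, dartMap g d = d) : g = 1 := by
  ext v
  obtain ⟨d, rfl⟩ := hg.ex v
  have := dartMap_fst g d
  rw [h] at this
  exact this.symm

theorem auto_three (hg : Good G σ) {g : G ≃g G} (h : dartMap g * σ * (dartMap g)⁻¹ = σ)
    (a b c : V) (hab : a ≠ b) (hac : a ≠ c)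
    (hbc : b ≠ c) (ga : g a = a) (gb : g b = b) (gc : g c = c) : g = 1 :=
  eq_one_of_dartMap hg (winding hg (dartMap g) g g.injective (dartMap_symm g) (conj_comm h)
    (dartMap_fst g) a b c hab hac hbc ga gb gc)

theorem auto_commute (hg : Good G σ) {g h : G ≃g G} (hgσ : dartMap g * σ * (dartMap g)⁻¹ = σ)
    (hhσ : dartMap h * σ * (dartMap h)⁻¹ = σ) (a : V) (ga : g a = a) (ha : h a = a) (v : V) :
    g (h v) = h (g v) := by
  have cg := conj_comm hgσ
  have ch := conj_comm hhσ
  have pw : ∀ (k : G ≃g G), (∀ d, dartMap k (σ d) = σ (dartMap k d)) → ∀ (n : ℕ) d,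
      dartMap k ((σ ^ n) d) = (σ ^ n) (dartMap k d) := by
    intro k hk n d
    induction n with
    | zero => rfl
    | succ n ih => rw [pow_succ', Equiv.Perm.mul_apply, hk, ih, Equiv.Perm.mul_apply]
  obtain ⟨da, hda⟩ := hg.ex a
  obtain ⟨n, hn⟩ := hg.rot.2 da (dartMap g da) (by
    change da.fst = g da.fst
    rw [hda, ga])
  obtain ⟨m, hm⟩ := hg.rot.2 da (dartMap h da) (by
    change da.fst = h da.fst
    rw [hda, ha])
  have h0 : dartMap g (dartMap h da) = dartMap h (dartMap g da) := by
    rw [← hm, pw g cg, ← hn, pw h ch, ← hm, ← Equiv.Perm.mul_apply, ← Equiv.Perm.mul_apply,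
      ← pow_add, ← pow_add, add_comm]
  have hall := conn_darts hg.rot hg.off0
    (fun d => dartMap g (dartMap h d) = dartMap h (dartMap g d))
    (fun d => propext (by
      simp only [dartMap_symm]
      exact SimpleGraph.Dart.symm_involutive.injective.eq_iff))
    (fun d => propext (by
      rw [ch, cg, cg, ch]
      exact σ.injective.eq_iff)) da
  obtain ⟨d, rfl⟩ := hg.ex v
  have := (hall d).mp h0
  exact congrArg (fun d : G.Dart => d.fst) this

end AuxE

/-- Let `G` be a 3-connected planar graph with vertex colors such that one vertex `a`
is colored distinctly, and let `k ≥ 2` be the size of the smallest color class apart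
from the one containing `a`. Then `G` has at most `4k` color-preserving
automorphisms. -/
theorem colored_threeconnected_automorphism_bound {V : Type*} [Fintype V]
    {Color : Type*} (G : SimpleGraph V)
    (h3 : ThreeConnectedGraph G) (hpl : HasPlanarEmbedding G)
    (c : V → Color) (a : V) (ha : ∀ v : V, c v = c a → v = a)
    (k : ℕ) (hk : 2 ≤ k)
    (hmin : ∀ d : Color, d ≠ c a → (∃ v : V, c v = d) →
      k ≤ Nat.card {v : V // c v = d})
    (hex : ∃ d : Color, d ≠ c a ∧ Nat.card {v : V // c v = d} = k) :
    Nat.card {φ : G ≃g G // ∀ v : V, c (φ v) = c v} ≤ 4 * k := by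
  classical
  obtain ⟨σ, hp⟩ := hpl
  have hg := good_of_planar h3 hp
  obtain ⟨col, hcol, hcard⟩ := hex
  have hfin : Finite (G ≃g G) :=
    Finite.of_injective (fun g : G ≃g G => (g : V → V)) DFunLike.coe_injective
  let H : Set (G ≃g G) := {φ | ∀ v : V, c (φ v) = c v}
  let Hp : Set (G ≃g G) := {φ | (∀ v : V, c (φ v) = c v) ∧ dartMap φ * σ * (dartMap φ)⁻¹ = σ}
  have hHa : ∀ φ ∈ H, φ a = a := fun φ hφ => ha _ (hφ a)
  have hmul : ∀ φ ψ, φ ∈ H → ψ ∈ H → φ * ψ ∈ H := fun φ ψ h1 h2 v => (h1 (ψ v)).trans (h2 v)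
  have hinv : ∀ φ, φ ∈ H → φ⁻¹ ∈ H := fun φ h1 v => by
    have := h1 (φ⁻¹ v)
    rw [← this]
    congr 1
    exact φ.apply_symm_apply v
  have hmulp : ∀ φ ψ, φ ∈ Hp → ψ ∈ Hp → φ⁻¹ * ψ ∈ Hp := by
    intro φ ψ h1 h2
    refine ⟨hmul _ _ (hinv _ h1.1) h2.1, ?_⟩
    rw [dartMap_mul, dartMap_inv]
    calc _ = (dartMap φ)⁻¹ * (dartMap ψ * σ * (dartMap ψ)⁻¹) * dartMap φ := by group
      _ = (dartMap φ)⁻¹ * (dartMap φ * σ * (dartMap φ)⁻¹) * dartMap φ := by rw [h2.2, h1.2]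
      _ = σ := by group
  -- the index of the rotation subgroup is at most two
  have hidx : H.ncard ≤ 2 * Hp.ncard := by
    by_cases hr : ∃ r ∈ H, r ∉ Hp
    · obtain ⟨r, hr, hrp⟩ := hr
      have hrσ : dartMap r * σ * (dartMap r)⁻¹ = σ⁻¹ := by
        rcases auto_dichotomy h3 hp r with h | h
        · exact absurd ⟨hr, h⟩ hrp
        · exact h
      have hsub : H ⊆ Hp ∪ Set.image (fun x => r⁻¹ * x) Hp := by
        intro x hx
        rcases auto_dichotomy h3 hp x with h | h
        · left; exact ⟨hx, h⟩
        · right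
          refine ⟨r * x, ⟨hmul _ _ hr hx, ?_⟩, by group⟩
          rw [dartMap_mul]
          calc _ = dartMap r * (dartMap x * σ * (dartMap x)⁻¹) * (dartMap r)⁻¹ := by group
            _ = (dartMap r * σ * (dartMap r)⁻¹)⁻¹ := by rw [h]; group
            _ = σ := by rw [hrσ, inv_inv]
      calc H.ncard ≤ (Hp ∪ Set.image (fun x => r⁻¹ * x) Hp).ncard := Set.ncard_le_ncard hsub
        _ ≤ Hp.ncard + (Set.image (fun x => r⁻¹ * x) Hp).ncard := Set.ncard_union_le _ _
        _ ≤ Hp.ncard + Hp.ncard := by exact Nat.add_le_add_left (Set.ncard_image_le (Set.toFinite Hp)) _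
        _ = 2 * Hp.ncard := by ring
    · push Not at hr
      have : H.ncard ≤ Hp.ncard := Set.ncard_le_ncard hr
      omega
  -- a vertex with trivial rotation stabiliser
  have hstab : ∃ v, c v = col ∧ ∀ φ ∈ Hp, φ v = v → φ = 1 := by
    by_contra! hcon
    have hlt : 1 < Nat.card {v : V // c v = col} := by omega
    rw [Finite.one_lt_card_iff_nontrivial] at hlt
    obtain ⟨⟨v1, hv1⟩, ⟨v2, hv2⟩, hne⟩ := hlt
    have hne : v1 ≠ v2 := fun h => hne (Subtype.ext h)
    obtain ⟨g, hgp, hg1, hgn⟩ := hcon v1 hv1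
    obtain ⟨h, hhp, hh2, hhn⟩ := hcon v2 hv2
    have a1 : a ≠ v1 := by rintro rfl; exact hcol hv1.symm
    have a2 : a ≠ v2 := by rintro rfl; exact hcol hv2.symm
    have hga := hHa g hgp.1
    have hha := hHa h hhp.1
    have hcomm := auto_commute hg hgp.2 hhp.2 a hga hha v1
    rw [hg1] at hcomm
    by_cases hh1 : h v1 = v1
    · exact hhn (auto_three hg hhp.2 a v1 v2 a1 a2 hne hha hh1 hh2)
    · refine hgn (auto_three hg hgp.2 a v1 (h v1) a1 ?_ (Ne.symm hh1) hga hg1 hcomm)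
      intro hav
      exact a1 (h.injective (hha.trans hav))
  obtain ⟨v, hv, hvs⟩ := hstab
  have hHp : Hp.ncard ≤ k := by
    rw [← hcard, ← Nat.card_coe_set_eq]
    refine Nat.card_le_card_of_injective
      (fun φ : Hp => (⟨φ.1 v, (φ.2.1 v).trans hv⟩ : {v : V // c v = col})) ?_
    rintro ⟨φ, hφ⟩ ⟨ψ, hψ⟩ h
    have h' : φ v = ψ v := congrArg Subtype.val h
    have := hvs _ (hmulp φ ψ hφ hψ) (by
      change φ.symm (ψ v) = v
      rw [← h']
      exact φ.symm_apply_apply v)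
    exact Subtype.ext (inv_mul_eq_one.1 this)
  have hH : Nat.card {φ : G ≃g G // ∀ v : V, c (φ v) = c v} = H.ncard :=
    Nat.card_coe_set_eq H
  rw [hH]
  omega
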